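/- Let K be a field, S = K[x,y,z,w], and I ⊆ S a monomial ideal such that Ass(S/I) = {(x,y), (x,z), (y,z)}. Then S/I is clean. -/

import Mathlib

open MvPolynomial

/-- The depth of an `S`-module `M` with respect to an ideal `m`: the supremum of
lengths of `M`-regular sequences consisting of elements of `m`. -/
noncomputable def mDepth (S : Type*) [CommRing S] (m : Ideal S)
    (M : Type*) [AddCommGroup M] [Module S M] : ℕ∞ :=
  sSup {n : ℕ∞ | ∃ rs : List S, (rs.length : ℕ∞) = n ∧ (∀ r ∈ rs, r ∈ m) ∧
    RingTheory.Sequence.IsRegular M rs}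

/-- `M` is a Cohen–Macaulay `S`-module (w.r.t. the ideal `m`) if its depth with
respect to `m` equals its Krull dimension, i.e. the Krull dimension of `S ⧸ ann M`. -/
def IsCM (S : Type*) [CommRing S] (m : Ideal S)
    (M : Type*) [AddCommGroup M] [Module S M] : Prop :=
  (mDepth S m M : WithBot ℕ∞) = ringKrullDim (S ⧸ Module.annihilator S M)

/-- `F` is a prime filtration `I = F₀ ⊆ F₁ ⊆ ... ⊆ F_r = S` with
`F_i/F_{i-1} ≅ S/P_i` for prime ideals `P_i`. -/
def IsPrimeFiltration {S : Type*} [CommRing S] (I : Ideal S) (r : ℕ)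
    (F : Fin (r + 1) → Ideal S) (P : Fin r → Ideal S) : Prop :=
  F 0 = I ∧ F (Fin.last r) = ⊤ ∧ (∀ i : Fin r, F i.castSucc ≤ F i.succ) ∧
  ∀ i : Fin r, (P i).IsPrime ∧
    Nonempty ((↥(Submodule.map (F i.castSucc).mkQ (F i.succ))) ≃ₗ[S] (S ⧸ P i))

/-- `S/I` is clean: it has a prime filtration all of whose primes are minimal
primes of `I`. -/
def IsClean {S : Type*} [CommRing S] (I : Ideal S) : Prop :=
  ∃ (r : ℕ) (F : Fin (r + 1) → Ideal S) (P : Fin r → Ideal S),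
    IsPrimeFiltration I r F P ∧ ∀ i, P i ∈ I.minimalPrimes

/-- `S/I` is pretty clean: it has a prime filtration such that `i ≤ j` and
`P i ⊆ P j` imply `P i = P j`. -/
def IsPrettyClean {S : Type*} [CommRing S] (I : Ideal S) : Prop :=
  ∃ (r : ℕ) (F : Fin (r + 1) → Ideal S) (P : Fin r → Ideal S),
    IsPrimeFiltration I r F P ∧ ∀ i j : Fin r, i ≤ j → P i ≤ P j → P i = P j

/-- A (finitely generated) `S`-module `M` is clean: it has a filtration
`0 = M₀ ⊆ M₁ ⊆ ... ⊆ M_r = M` with `M_i/M_{i-1} ≅ S/P_i` where each `P_i` is a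
minimal prime of the support of `M`, i.e. a minimal prime over `ann M`. -/
def IsCleanModule (S : Type*) [CommRing S] (M : Type*) [AddCommGroup M] [Module S M] : Prop :=
  ∃ (r : ℕ) (F : Fin (r + 1) → Submodule S M) (P : Fin r → Ideal S),
    F 0 = ⊥ ∧ F (Fin.last r) = ⊤ ∧ (∀ i : Fin r, F i.castSucc ≤ F i.succ) ∧
    (∀ i : Fin r, (P i).IsPrime ∧
      Nonempty ((↥(F i.succ) ⧸ (Submodule.comap (F i.succ).subtype (F i.castSucc)))
        ≃ₗ[S] (S ⧸ P i))) ∧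
    ∀ i, P i ∈ (Module.annihilator S M).minimalPrimes

/-- An ideal of a polynomial ring is a monomial ideal if it is generated by monomials. -/
def IsMonomialIdeal {σ K : Type*} [CommSemiring K] (I : Ideal (MvPolynomial σ K)) : Prop :=
  ∃ G : Set (MvPolynomial σ K),
    (∀ g ∈ G, ∃ e : σ →₀ ℕ, g = MvPolynomial.monomial e 1) ∧ I = Ideal.span G

/-- The height of an ideal: the infimum of the heights of the primes containing it. -/
noncomputable def idealHeight {S : Type*} [CommRing S] (I : Ideal S) : ℕ∞ :=
  sInf {n : ℕ∞ | ∃ q : PrimeSpectrum S, I ≤ q.asIdeal ∧ Order.height q = n}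

variable {K : Type*} [Field K]

local notation "S" => MvPolynomial (Fin 4) K
local notation "m4" => (Ideal.span {(X 0 : MvPolynomial (Fin 4) K), X 1, X 2, X 3})

/-- `I` has a prime filtration all of whose primes lie in `T`. -/
def HasPrimeFiltrationIn {R : Type*} [CommRing R] (T : Set (Ideal R)) (I : Ideal R) : Prop :=
  ∃ (r : ℕ) (F : Fin (r + 1) → Ideal R) (P : Fin r → Ideal R),
    IsPrimeFiltration I r F P ∧ ∀ i, P i ∈ T

section Filtration

variable {R : Type*} [CommRing R] {T : Set (Ideal R)}

theorem HasPrimeFiltrationIn.top : HasPrimeFiltrationIn T (⊤ : Ideal R) :=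
  ⟨0, fun _ => ⊤, Fin.elim0, ⟨rfl, rfl, fun i => i.elim0, fun i => i.elim0⟩, fun i => i.elim0⟩

theorem HasPrimeFiltrationIn.cons {I J P : Ideal R} (hIJ : I ≤ J) (hP : P.IsPrime) (hPT : P ∈ T)
    (e : Nonempty (↥(Submodule.map I.mkQ J) ≃ₗ[R] (R ⧸ P))) (hJ : HasPrimeFiltrationIn T J) :
    HasPrimeFiltrationIn T I := by
  obtain ⟨r, F, Q, ⟨h0, hlast, hle, hq⟩, hT⟩ := hJ
  subst h0
  refine ⟨r + 1, Fin.cons I F, Fin.cons P Q, ⟨rfl, ?_, ?_, ?_⟩, ?_⟩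
  · rw [← Fin.succ_last, Fin.cons_succ, hlast]
  · refine Fin.cases ?_ fun i => ?_
    · simpa using hIJ
    · simpa [← Fin.succ_castSucc] using hle i
  · refine Fin.cases ⟨hP, e⟩ fun i => ?_
    exact hq i
  · exact Fin.cases hPT hT

/-- Adjoining to `I` an element `u` with `I : u = P` gives a quotient isomorphic to `R ⧸ P`. -/
theorem nonempty_map_mkQ_sup_span_singleton_equiv {I P : Ideal R} (u : R)
    (h : ∀ f, f * u ∈ I ↔ f ∈ P) :
    Nonempty (↥(Submodule.map I.mkQ (I ⊔ Ideal.span {u})) ≃ₗ[R] (R ⧸ P)) := by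
  have h1 : Submodule.map I.mkQ (I ⊔ Ideal.span {u}) = Submodule.span R {I.mkQ u} := by
    rw [Submodule.map_sup, Submodule.mkQ_map_self, bot_sup_eq, Ideal.span,
      Submodule.map_span, Set.image_singleton]
  have h2 : Ideal.torsionOf R (R ⧸ I) (I.mkQ u) = P := by
    ext f
    rw [Ideal.mem_torsionOf_iff, ← h, ← map_smul, Submodule.mkQ_apply,
      Submodule.Quotient.mk_eq_zero, smul_eq_mul]
  exact ⟨(LinearEquiv.ofEq _ _ h1).trans
    ((Ideal.quotTorsionOfEquivSpanSingleton R (R ⧸ I) (I.mkQ u)).symm.trans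
      (Submodule.quotEquivOfEq _ _ h2))⟩

end Filtration

section MonomialIdeals

variable {σ : Type*}

theorem mem_span_monomial_image_iff_of_isUpperSet {U : Set (σ →₀ ℕ)} (hU : IsUpperSet U)
    {f : MvPolynomial σ K} :
    f ∈ Ideal.span ((fun s => monomial s (1 : K)) '' U) ↔ ∀ e ∈ f.support, e ∈ U := by
  rw [mem_ideal_span_monomial_image]
  exact forall₂_congr fun e _ => ⟨fun ⟨s, hs, hse⟩ => hU hse hs, fun he => ⟨e, he, le_rfl⟩⟩

theorem mul_monomial_mem_span_monomial_image_iff {U : Set (σ →₀ ℕ)} (hU : IsUpperSet U)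
    {f : MvPolynomial σ K} {u : σ →₀ ℕ} :
    f * monomial u 1 ∈ Ideal.span ((fun s => monomial s (1 : K)) '' U) ↔
      ∀ e ∈ f.support, e + u ∈ U := by
  classical
  rw [mem_span_monomial_image_iff_of_isUpperSet hU]
  constructor
  · intro h e he
    refine h _ ?_
    rw [mem_support_iff, coeff_mul_monomial]
    simpa using he
  · intro h e he
    rw [mem_support_iff, coeff_mul_monomial'] at he
    split_ifs at he with hue
    · have := h (e - u) (by simpa using he)
      rwa [tsub_add_cancel_of_le hue] at this
    · exact absurd rfl he

theorem X_mem_span_X_image_iff {s : Set σ} {a : σ} :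
    (X a : MvPolynomial σ K) ∈ Ideal.span (X '' s) ↔ a ∈ s := by
  classical
  rw [mem_ideal_span_X_image]
  simp [support_X, Finsupp.single_apply]

/-- A monomial ideal is spanned by the monomials it contains. -/
theorem IsMonomialIdeal.eq_span {I : Ideal (MvPolynomial σ K)} (hI : IsMonomialIdeal I) :
    I = Ideal.span ((fun s => monomial s (1 : K)) '' {e | monomial e (1 : K) ∈ I}) := by
  obtain ⟨G, hG, hIG⟩ := hI
  refine le_antisymm ?_ (Ideal.span_le.2 ?_)
  · conv_lhs => rw [hIG]
    refine Ideal.span_le.2 fun g hg => ?_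
    obtain ⟨e, rfl⟩ := hG g hg
    exact Ideal.subset_span ⟨e, hIG ▸ Ideal.subset_span hg, rfl⟩
  · rintro _ ⟨e, he, rfl⟩
    exact he

theorem monomial_mem_of_le {I : Ideal (MvPolynomial σ K)} {e e' : σ →₀ ℕ} (h : e ≤ e')
    (he : monomial e (1 : K) ∈ I) : monomial e' (1 : K) ∈ I := by
  have := I.mul_mem_left (monomial (e' - e) 1) he
  rwa [monomial_mul, one_mul, tsub_add_cancel_of_le h] at this

end MonomialIdeals

/-- The first coordinate of the `k`-th pair among `(0, 1)`, `(0, 2)`, `(1, 2)`. -/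
def pairFst : Fin 3 → Fin 4 := ![0, 0, 1]

/-- The second coordinate of the `k`-th pair among `(0, 1)`, `(0, 2)`, `(1, 2)`. -/
def pairSnd : Fin 3 → Fin 4 := ![1, 2, 2]

/-- The projection of an exponent vector to the `k`-th coordinate plane. -/
def planeProj (k : Fin 3) (e : Fin 4 →₀ ℕ) : ℕ × ℕ := (e (pairFst k), e (pairSnd k))

theorem planeProj_mono (k : Fin 3) : Monotone (planeProj k) :=
  fun _ _ h => ⟨h _, h _⟩

/-- The exponent vectors whose projection to the `k`-th coordinate plane avoids `D k`. -/
def avoiding (D : Fin 3 → Finset (ℕ × ℕ)) : Set (Fin 4 →₀ ℕ) :=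
  {e | ∀ k, planeProj k e ∉ D k}

theorem isUpperSet_avoiding {D : Fin 3 → Finset (ℕ × ℕ)}
    (hD : ∀ k, IsLowerSet (D k : Set (ℕ × ℕ))) : IsUpperSet (avoiding D) :=
  fun _ _ hab ha k hb => ha k (hD k (planeProj_mono k hab) hb)

theorem exists_row_bound {A : Finset (ℕ × ℕ)} (hA : IsLowerSet (A : Set (ℕ × ℕ))) (a : ℕ) :
    ∃ n, ∀ t, (a, t) ∉ A ↔ n ≤ t := by
  classical
  have hex : ∃ t, (a, t) ∉ A := ⟨A.sup Prod.snd + 1, fun h => by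
    exact (Finset.le_sup (f := Prod.snd) h).not_gt (Nat.lt_succ_self _)⟩
  refine ⟨Nat.find hex, fun t => ⟨fun h => Nat.find_min' hex h, fun h ht => ?_⟩⟩
  exact Nat.find_spec hex (hA (⟨le_rfl, h⟩ : (a, Nat.find hex) ≤ (a, t)) ht)

theorem exists_column_bound {A : Finset (ℕ × ℕ)} (hA : IsLowerSet (A : Set (ℕ × ℕ))) (b : ℕ) :
    ∃ n, ∀ t, (t, b) ∉ A ↔ n ≤ t := by
  classical
  have hex : ∃ t, (t, b) ∉ A := ⟨A.sup Prod.fst + 1, fun h => by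
    exact (Finset.le_sup (f := Prod.fst) h).not_gt (Nat.lt_succ_self _)⟩
  refine ⟨Nat.find hex, fun t => ⟨fun h => Nat.find_min' hex h, fun h ht => ?_⟩⟩
  exact Nat.find_spec hex (hA (⟨h, le_rfl⟩ : (Nat.find hex, b) ≤ (t, b)) ht)

theorem exists_isLeast_fiber {D : Fin 3 → Finset (ℕ × ℕ)}
    (hD : ∀ k, IsLowerSet (D k : Set (ℕ × ℕ))) (k : Fin 3) (p : ℕ × ℕ) :
    ∃ u, IsLeast {e | planeProj k e = p ∧ ∀ l ≠ k, planeProj l e ∉ D l} u := by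
  obtain ⟨a, b⟩ := p
  fin_cases k
  · obtain ⟨m, hm⟩ := exists_row_bound (hD 1) a
    obtain ⟨n, hn⟩ := exists_row_bound (hD 2) b
    refine ⟨Finsupp.equivFunOnFinite.symm ![a, b, max m n, 0], ?_, ?_⟩
    · simp [planeProj, pairFst, pairSnd, Fin.forall_fin_succ, hm, hn]
    · rintro e ⟨he, hl⟩ i
      simp only [planeProj, pairFst, pairSnd, Prod.mk.injEq] at he
      have h1 := hl 1 (by decide)
      have h2 := hl 2 (by decide)
      simp_all [planeProj, pairFst, pairSnd]
      fin_cases i <;> simp_all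
  · obtain ⟨m, hm⟩ := exists_row_bound (hD 0) a
    obtain ⟨n, hn⟩ := exists_column_bound (hD 2) b
    refine ⟨Finsupp.equivFunOnFinite.symm ![a, max m n, b, 0], ?_, ?_⟩
    · simp [planeProj, pairFst, pairSnd, Fin.forall_fin_succ, hm, hn]
    · rintro e ⟨he, hl⟩ i
      simp only [planeProj, pairFst, pairSnd, Prod.mk.injEq] at he
      have h1 := hl 0 (by decide)
      have h2 := hl 2 (by decide)
      simp_all [planeProj, pairFst, pairSnd]
      fin_cases i <;> simp_all
  · obtain ⟨m, hm⟩ := exists_column_bound (hD 0) a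
    obtain ⟨n, hn⟩ := exists_column_bound (hD 1) b
    refine ⟨Finsupp.equivFunOnFinite.symm ![max m n, a, b, 0], ?_, ?_⟩
    · simp [planeProj, pairFst, pairSnd, Fin.forall_fin_succ, hm, hn]
    · rintro e ⟨he, hl⟩ i
      simp only [planeProj, pairFst, pairSnd, Prod.mk.injEq] at he
      have h1 := hl 0 (by decide)
      have h2 := hl 1 (by decide)
      simp_all [planeProj, pairFst, pairSnd]
      fin_cases i <;> simp_all

variable (K) in
/-- The prime ideal generated by the two variables of the `k`-th pair. -/
noncomputable def pairIdeal (k : Fin 3) : Ideal (MvPolynomial (Fin 4) K) :=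
  Ideal.span (X '' {pairFst k, pairSnd k})

theorem mem_pairIdeal {k : Fin 3} {f : MvPolynomial (Fin 4) K} :
    f ∈ pairIdeal K k ↔ ∀ e ∈ f.support, planeProj k e ≠ 0 := by
  rw [pairIdeal, mem_ideal_span_X_image]
  refine forall₂_congr fun e _ => ?_
  simp [planeProj, Prod.ext_iff, imp_iff_not_or]

variable (K) in
/-- The monomial ideal of exponent vectors avoiding the plane sets `D k`. -/
noncomputable def avoidingIdeal (D : Fin 3 → Finset (ℕ × ℕ)) : Ideal (MvPolynomial (Fin 4) K) :=
  Ideal.span ((fun s => monomial s (1 : K)) '' avoiding D)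

theorem avoiding_subset_update_erase (D : Fin 3 → Finset (ℕ × ℕ)) (k : Fin 3) (p : ℕ × ℕ) :
    avoiding D ⊆ avoiding (Function.update D k ((D k).erase p)) := by
  intro e he l
  rcases eq_or_ne l k with rfl | hl
  · simpa using fun _ => he l
  · simpa [hl] using he l

/-- Erasing a maximal element of `D k` adjoins one monomial to the ideal, and the successive
quotient is cyclic with annihilator `pairIdeal K k`. -/
theorem exists_avoidingIdeal_update_erase {D : Fin 3 → Finset (ℕ × ℕ)}
    (hD : ∀ k, IsLowerSet (D k : Set (ℕ × ℕ))) {k : Fin 3} {p : ℕ × ℕ}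
    (hp : Maximal (· ∈ D k) p) :
    ∃ g : MvPolynomial (Fin 4) K,
      avoidingIdeal K (Function.update D k ((D k).erase p)) =
        avoidingIdeal K D ⊔ Ideal.span {g} ∧
      ∀ f, f * g ∈ avoidingIdeal K D ↔ f ∈ pairIdeal K k := by
  obtain ⟨u, ⟨hu, hul⟩, hmin⟩ := exists_isLeast_fiber hD k p
  refine ⟨monomial u 1, le_antisymm (Ideal.span_le.2 ?_) (sup_le ?_ ?_), fun f => ?_⟩
  · rintro _ ⟨e, he, rfl⟩
    by_cases hpe : planeProj k e = p
    · have hue : u ≤ e := hmin ⟨hpe, fun l hl => by simpa [hl] using he l⟩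
      exact monomial_mem_of_le hue
        (Ideal.mem_sup_right (Ideal.mem_span_singleton_self _))
    · refine Ideal.mem_sup_left (Ideal.subset_span ⟨e, fun l => ?_, rfl⟩)
      rcases eq_or_ne l k with rfl | hl
      · simpa [hpe] using he l
      · simpa [hl] using he l
  · exact Ideal.span_mono (Set.image_mono (avoiding_subset_update_erase D k p))
  · rw [Ideal.span_singleton_le_iff_mem]
    refine Ideal.subset_span ⟨u, fun l => ?_, rfl⟩
    rcases eq_or_ne l k with rfl | hl
    · simp [hu]
    · simpa [hl] using hul l hl
  · rw [avoidingIdeal, mul_monomial_mem_span_monomial_image_iff (isUpperSet_avoiding hD),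
      mem_pairIdeal]
    refine forall₂_congr fun e _ => ?_
    have hadd : planeProj k (e + u) = planeProj k e + p := by
      rw [← hu]
      rfl
    constructor
    · intro h h0
      refine h k ?_
      rw [hadd, h0, zero_add]
      exact hp.prop
    · intro h l hl
      rcases eq_or_ne l k with rfl | hlk
      · rw [hadd] at hl
        refine h (le_antisymm ?_ zero_le)
        have := hp.le_of_ge hl le_add_self
        simpa using this
      · exact hul l hlk (hD l (planeProj_mono l le_add_self) hl)

theorem isLowerSet_update_erase {D : Fin 3 → Finset (ℕ × ℕ)}
    (hD : ∀ k, IsLowerSet (D k : Set (ℕ × ℕ))) {k : Fin 3} {p : ℕ × ℕ}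
    (hp : Maximal (· ∈ D k) p) (l : Fin 3) :
    IsLowerSet (Function.update D k ((D k).erase p) l : Set (ℕ × ℕ)) := by
  rcases eq_or_ne l k with rfl | hl
  · intro a b hba ha
    simp only [Function.update_self, Finset.mem_coe, Finset.mem_erase] at ha ⊢
    refine ⟨?_, hD l hba ha.2⟩
    rintro rfl
    exact ha.1 (hp.eq_of_ge ha.2 hba)
  · simpa [hl] using hD l

theorem hasPrimeFiltrationIn_avoidingIdeal {T : Set (Ideal (MvPolynomial (Fin 4) K))}
    (hT : ∀ k, pairIdeal K k ∈ T) (hprime : ∀ k, (pairIdeal K k).IsPrime)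
    (D : Fin 3 → Finset (ℕ × ℕ)) (hD : ∀ k, IsLowerSet (D k : Set (ℕ × ℕ))) :
    HasPrimeFiltrationIn T (avoidingIdeal K D) := by
  induction hn : ∑ k, (D k).card generalizing D with
  | zero =>
    have hempty : ∀ k, D k = ∅ := by simpa using hn
    have : avoidingIdeal K D = ⊤ := by
      rw [Ideal.eq_top_iff_one]
      exact Ideal.subset_span ⟨0, fun k => by simp [hempty], rfl⟩
    rw [this]
    exact HasPrimeFiltrationIn.top
  | succ n ih =>
    obtain ⟨k, hk⟩ : ∃ k, (D k).Nonempty := by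
      by_contra! h
      simp [h] at hn
    obtain ⟨p, hp⟩ := (D k).exists_maximal hk
    obtain ⟨g, hg, hcolon⟩ := exists_avoidingIdeal_update_erase (K := K) hD hp
    refine HasPrimeFiltrationIn.cons (J := avoidingIdeal K D ⊔ Ideal.span {g}) le_sup_left
      (hprime k) (hT k) (nonempty_map_mkQ_sup_span_singleton_equiv g hcolon) ?_
    rw [← hg]
    refine ih _ (isLowerSet_update_erase hD hp) ?_
    have hcard := Finset.card_erase_add_one hp.prop
    rw [← Finset.add_sum_erase _ _ (Finset.mem_univ k)] at hn ⊢
    rw [Function.update_self, Finset.sum_congr rfl fun l hl => by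
      rw [Function.update_of_ne (Finset.ne_of_mem_erase hl)]]
    omega

theorem minimalPrimes_subset_associatedPrimes_quotient {R : Type*} [CommRing R]
    [IsNoetherianRing R] (I : Ideal R) : I.minimalPrimes ⊆ associatedPrimes R (R ⧸ I) := by
  have := Module.associatedPrimes.minimalPrimes_annihilator_subset_associatedPrimes R (R ⧸ I)
  rwa [Ideal.annihilator_quotient] at this

theorem pairIdeal_le_iff {k l : Fin 3} : pairIdeal K k ≤ pairIdeal K l ↔ k = l := by
  refine ⟨fun h => ?_, fun h => h ▸ le_rfl⟩
  have h1 : X (pairFst k) ∈ pairIdeal K l := h (Ideal.subset_span ⟨_, by simp, rfl⟩)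
  have h2 : X (pairSnd k) ∈ pairIdeal K l := h (Ideal.subset_span ⟨_, by simp, rfl⟩)
  rw [pairIdeal, X_mem_span_X_image_iff] at h1 h2
  simp only [Set.mem_insert_iff, Set.mem_singleton_iff] at h1 h2
  clear h
  revert k l
  decide

theorem pairIdeal_mem_minimalPrimes {I : Ideal (MvPolynomial (Fin 4) K)}
    (hAss : associatedPrimes _ (MvPolynomial (Fin 4) K ⧸ I) = Set.range (pairIdeal K))
    (k : Fin 3) : pairIdeal K k ∈ I.minimalPrimes := by
  have hk : pairIdeal K k ∈ associatedPrimes _ (MvPolynomial (Fin 4) K ⧸ I) := by simp [hAss]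
  have := hk.isPrime
  have hle : I ≤ pairIdeal K k := by
    rw [← Ideal.annihilator_quotient (I := I), ← Submodule.annihilator_top]
    exact IsAssociatedPrime.annihilator_le hk
  obtain ⟨p, hp, hpk⟩ := Ideal.exists_minimalPrimes_le hle
  obtain ⟨l, rfl⟩ := hAss ▸ minimalPrimes_subset_associatedPrimes_quotient I hp
  rwa [pairIdeal_le_iff.1 hpk] at hp

/-- For every variable `X i`, some monomial of `I` does not involve `X i`. -/
theorem exists_monomial_mem_apply_eq_zero {I : Ideal (MvPolynomial (Fin 4) K)}
    (hI : IsMonomialIdeal I)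
    (hAss : associatedPrimes _ (MvPolynomial (Fin 4) K ⧸ I) = Set.range (pairIdeal K))
    (i : Fin 4) : ∃ e : Fin 4 →₀ ℕ, monomial e (1 : K) ∈ I ∧ e i = 0 := by
  by_contra! h
  have hle : I ≤ Ideal.span (X '' {i}) := by
    rw [hI.eq_span]
    refine Ideal.span_le.2 ?_
    rintro _ ⟨e, he, rfl⟩
    refine mem_ideal_span_X_image.2 fun m hm => ⟨i, rfl, ?_⟩
    rw [Finset.mem_singleton.1 (support_monomial_subset hm)]
    exact h e he
  have hprime : (Ideal.span (X '' {i}) : Ideal (MvPolynomial (Fin 4) K)).IsPrime := by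
    rw [Set.image_singleton, Ideal.span_singleton_prime (X_ne_zero i)]
    exact X_prime
  obtain ⟨p, hp, hpi⟩ := Ideal.exists_minimalPrimes_le hle
  obtain ⟨k, rfl⟩ := hAss ▸ minimalPrimes_subset_associatedPrimes_quotient I hp
  have h1 : X (pairFst k) ∈ Ideal.span (X '' {i}) := hpi (Ideal.subset_span ⟨_, by simp, rfl⟩)
  have h2 : X (pairSnd k) ∈ Ideal.span (X '' {i}) := hpi (Ideal.subset_span ⟨_, by simp, rfl⟩)
  rw [X_mem_span_X_image_iff, Set.mem_singleton_iff] at h1 h2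
  have hne : ∀ k, pairFst k ≠ pairSnd k := by decide
  exact hne k (h1.trans h2.symm)

theorem exists_planeProj_forall_notMem {I : Ideal (MvPolynomial (Fin 4) K)}
    (hAss : associatedPrimes _ (MvPolynomial (Fin 4) K ⧸ I) = Set.range (pairIdeal K))
    {u : Fin 4 →₀ ℕ} (hu : monomial u (1 : K) ∉ I) :
    ∃ k, ∀ e, planeProj k e ≤ planeProj k u → monomial e (1 : K) ∉ I := by
  have hne : Ideal.Quotient.mk I (monomial u (1 : K)) ≠ 0 := by
    rwa [Ne, Ideal.Quotient.eq_zero_iff_mem]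
  obtain ⟨P, hP, hle⟩ := exists_le_isAssociatedPrime_of_isNoetherianRing
    (MvPolynomial (Fin 4) K) _ hne
  obtain ⟨k, rfl⟩ : P ∈ Set.range (pairIdeal K) := hAss ▸ hP
  refine ⟨k, fun e he hmem => ?_⟩
  have hcolon : monomial (e ⊔ u - u) (1 : K) ∈ pairIdeal K k := by
    refine hle ?_
    rw [Submodule.mem_colon_singleton, Submodule.mem_bot, ← Ideal.Quotient.mk_eq_mk,
      ← Submodule.Quotient.mk_smul, Submodule.Quotient.mk_eq_zero, smul_eq_mul, monomial_mul,
      one_mul, tsub_add_cancel_of_le le_sup_right]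
    exact monomial_mem_of_le le_sup_left hmem
  refine mem_pairIdeal.1 hcolon (e ⊔ u - u) (by simp) ?_
  simpa [planeProj, Prod.ext_iff, Prod.le_def, Nat.sub_eq_zero_iff_le] using he

/-- A monomial ideal whose associated primes are the pair ideals is of the form `avoidingIdeal K D`. -/
theorem exists_eq_avoidingIdeal {I : Ideal (MvPolynomial (Fin 4) K)} (hI : IsMonomialIdeal I)
    (hAss : associatedPrimes _ (MvPolynomial (Fin 4) K ⧸ I) = Set.range (pairIdeal K)) :
    ∃ D : Fin 3 → Finset (ℕ × ℕ),
      (∀ k, IsLowerSet (D k : Set (ℕ × ℕ))) ∧ I = avoidingIdeal K D := by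
  let A : Fin 3 → Set (ℕ × ℕ) := fun k => {p | ∀ e, planeProj k e ≤ p → monomial e (1 : K) ∉ I}
  have hA : ∀ k, (A k).Finite := by
    intro k
    obtain ⟨e, he, he0⟩ := exists_monomial_mem_apply_eq_zero hI hAss (pairFst k)
    obtain ⟨e', he', he0'⟩ := exists_monomial_mem_apply_eq_zero hI hAss (pairSnd k)
    refine (Set.finite_Iic (e' (pairFst k), e (pairSnd k))).subset fun p hp => ?_
    refine ⟨?_, ?_⟩
    · by_contra! h
      exact hp e' ⟨h.le, by simp [planeProj, he0']⟩ he'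
    · by_contra! h
      exact hp e ⟨by simp [planeProj, he0], h.le⟩ he
  refine ⟨fun k => (hA k).toFinset, fun k p q hqp hp => ?_, ?_⟩
  · simp only [Set.Finite.coe_toFinset] at hp ⊢
    exact fun e he => hp e (he.trans hqp)
  · have hset : {e | monomial e (1 : K) ∈ I} = avoiding fun k => (hA k).toFinset := by
      ext e
      simp only [Set.mem_ofPred_eq, avoiding, Set.Finite.mem_toFinset]
      refine ⟨fun he k hk => hk e le_rfl he, fun he => ?_⟩
      by_contra hmem
      obtain ⟨k, hk⟩ := exists_planeProj_forall_notMem hAss hmem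
      exact he k hk
    rw [avoidingIdeal, ← hset]
    exact hI.eq_span

/-- If `I ⊆ K[x,y,z,w]` is a monomial ideal with
`Ass(S/I) = {(x,y), (x,z), (y,z)}`, then `S/I` is clean. -/
theorem stmt_6 (I : Ideal S) (hI : IsMonomialIdeal I)
    (hAss : associatedPrimes S (S ⧸ I) =
      {Ideal.span {X 0, X 1}, Ideal.span {X 0, X 2}, Ideal.span {X 1, X 2}}) :
    IsClean I := by
  have hrange : Set.range (pairIdeal K) =
      {Ideal.span {X 0, X 1}, Ideal.span {X 0, X 2}, Ideal.span {X 1, X 2}} := by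
    ext P
    simp [pairIdeal, pairFst, pairSnd, Fin.exists_fin_succ, Set.image_pair, eq_comm]
  rw [← hrange] at hAss
  obtain ⟨D, hD, hID⟩ := exists_eq_avoidingIdeal hI hAss
  have hmin := pairIdeal_mem_minimalPrimes hAss
  have := hasPrimeFiltrationIn_avoidingIdeal hmin (fun k => (hmin k).isPrime) D hD
  rwa [← hID] at this
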